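/- arXiv:2011.09206 — 2 statements merged into one kernel-verified Lean document; each statement's English description precedes it below -/
import Mathlib

section
/- Let N ≥ 2, let W_0, …, W_{N−1} be symmetric positive definite n×n real matrices, let E_0, …, E_{N−1} be n×n real matrices, and fix x_0, x_N ∈ ℝ^n. Then the function f : (ℝ^n)^{N−1} → ℝ defined on the intermediate states by f(x_1, …, x_{N−1}) = Σ_{k=0}^{N−1} (x_{k+1} − E_k x_k)ᵀ W_k^{-1} (x_{k+1} − E_k x_k) is strictly convex; consequently f has at most one global minimizer. -/
open Matrix

/-- The quadratic form of a real positive definite matrix is strictly convex. -/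
theorem Matrix.PosDef.strictConvexOn_dotProduct_mulVec {ι : Type*} [Fintype ι]
    {M : Matrix ι ι ℝ} (hM : M.PosDef) :
    StrictConvexOn ℝ Set.univ fun x : ι → ℝ => x ⬝ᵥ (M *ᵥ x) := by
  refine ⟨convex_univ, fun p _ q _ hpq a b ha hb hab => ?_⟩
  have hpos : 0 < (p - q) ⬝ᵥ (M *ᵥ (p - q)) := by
    simpa using hM.dotProduct_mulVec_pos (sub_ne_zero.mpr hpq)
  have hgap := mul_pos (mul_pos ha hb) hpos
  obtain rfl : b = 1 - a := by linarith
  simp only [mulVec_sub, mulVec_add, mulVec_smul, dotProduct_sub, sub_dotProduct,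
    dotProduct_add, add_dotProduct, dotProduct_smul, smul_dotProduct, smul_eq_mul] at hgap ⊢
  linarith

/-- The total energy, as a function of the intermediate states
`x_1, …, x_{N−1}` (endpoints `x_0`, `x_N` fixed), i.e.
`f(x_1,…,x_{N−1}) = Σ_{k<N} (x_{k+1} − E_k x_k)ᵀ W_k⁻¹ (x_{k+1} − E_k x_k)` with each
`W_k` symmetric positive definite, is strictly convex; hence it has at most one global
minimizer. -/
theorem energy_strictConvex_unique_minimizer
    (n N : ℕ) (hN : 2 ≤ N)
    (W : ℕ → Matrix (Fin n) (Fin n) ℝ) (hWpd : ∀ k < N, (W k).PosDef)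
    (E : ℕ → Matrix (Fin n) (Fin n) ℝ)
    (x0 xN : Fin n → ℝ)
    (X : (Fin (N - 1) → Fin n → ℝ) → ℕ → Fin n → ℝ)
    (hX : ∀ v k, X v k =
      if h : 0 < k ∧ k < N then v ⟨k - 1, by omega⟩
      else if k = 0 then x0 else xN)
    (f : (Fin (N - 1) → Fin n → ℝ) → ℝ)
    (hf : ∀ v, f v = ∑ k ∈ Finset.range N,
      (X v (k + 1) - E k *ᵥ X v k) ⬝ᵥ ((W k)⁻¹ *ᵥ (X v (k + 1) - E k *ᵥ X v k))) :
    StrictConvexOn ℝ Set.univ f ∧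
    ∀ v w, (∀ z, f v ≤ f z) → (∀ z, f w ≤ f z) → v = w := by
  have hX_zero (v) : X v 0 = x0 := by simp [hX]
  have hX_comb (v w) (a b : ℝ) (hab : a + b = 1) (k) :
      X (a • v + b • w) k = a • X v k + b • X w k := by
    simp only [hX]
    split_ifs
    · rfl
    · rw [← add_smul, hab, one_smul]
    · rw [← add_smul, hab, one_smul]
  have hr_comb (v w) (a b : ℝ) (hab : a + b = 1) (k) :
      X (a • v + b • w) (k + 1) - E k *ᵥ X (a • v + b • w) k =
        a • (X v (k + 1) - E k *ᵥ X v k) + b • (X w (k + 1) - E k *ᵥ X w k) := by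
    rw [hX_comb v w a b hab, hX_comb v w a b hab, mulVec_add, mulVec_smul, mulVec_smul]
    module
  have hr_inj (v w)
      (h : ∀ k < N, X v (k + 1) - E k *ᵥ X v k = X w (k + 1) - E k *ᵥ X w k) : v = w := by
    have hXeq : ∀ k ≤ N, X v k = X w k := by
      intro k
      induction k with
      | zero => simp [hX_zero]
      | succ k ih =>
        intro hk
        have hstep := h k hk
        rwa [ih (by omega), sub_left_inj] at hstep
    funext i
    have hi : 0 < i.val + 1 ∧ i.val + 1 < N := by omega
    simpa [hX, hi.2] using hXeq (i.val + 1) hi.2.le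
  have hQ (k) (hk : k < N) := (hWpd k hk).inv.strictConvexOn_dotProduct_mulVec
  have hconv : StrictConvexOn ℝ Set.univ f := by
    refine ⟨convex_univ, fun v _ w _ hvw a b ha hb hab => ?_⟩
    obtain ⟨k, hk, hne⟩ : ∃ k < N,
        X v (k + 1) - E k *ᵥ X v k ≠ X w (k + 1) - E k *ᵥ X w k := by
      by_contra! h
      exact hvw (hr_inj v w h)
    simp only [hf, hr_comb v w a b hab, Finset.smul_sum, ← Finset.sum_add_distrib]
    refine Finset.sum_lt_sum (fun j hj => ?_) ⟨k, Finset.mem_range.mpr hk, ?_⟩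
    · exact (hQ j (Finset.mem_range.mp hj)).convexOn.2 trivial trivial ha.le hb.le hab
    · exact (hQ k hk).2 trivial trivial hne ha hb hab
  exact ⟨hconv, fun v w hv hw =>
    hconv.eq_of_isMinOn (fun z _ => hv z) (fun z _ => hw z) trivial trivial⟩
end

section
/- Let a₁, a₂, g be real numbers with g ≠ 0, and define q_x : ℝ⁵ → ℝ by q_x(φ, θ, ψ, z, v) = (sin φ · sin ψ / (cos φ · cos θ) + sin θ · cos ψ / cos θ) · (1 − (a₂/g) v − (a₁/g) z) − θ. Then q_x(0,0,0,0,0) = 0 and the (Fréchet) derivative of q_x at the origin is the zero linear map, i.e., all five partial derivatives of q_x vanish at the origin. -/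
/-- The nonlinear uncertainty signal `q_x(φ, θ, ψ, z, v)` vanishes
at the origin together with its Fréchet derivative. Here `v : Fin 5 → ℝ` packs
`(φ, θ, ψ, z, v) = (v 0, v 1, v 2, v 3, v 4)`. -/
theorem qx_zero_and_fderiv_zero
    (a₁ a₂ g : ℝ) (hg : g ≠ 0)
    (qx : (Fin 5 → ℝ) → ℝ)
    (hqx : ∀ v : Fin 5 → ℝ, qx v =
      (Real.sin (v 0) * Real.sin (v 2) / (Real.cos (v 0) * Real.cos (v 1))
        + Real.sin (v 1) * Real.cos (v 2) / Real.cos (v 1))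
      * (1 - (a₂ / g) * v 4 - (a₁ / g) * v 3) - v 1) :
    qx 0 = 0 ∧ HasFDerivAt qx (0 : (Fin 5 → ℝ) →L[ℝ] ℝ) 0 := by
  obtain rfl : qx = _ := funext hqx
  refine ⟨by simp, ?_⟩
  have h (i : Fin 5) : HasFDerivAt (fun v : Fin 5 → ℝ => v i)
      (ContinuousLinearMap.proj (R := ℝ) (φ := fun _ : Fin 5 => ℝ) i) 0 :=
    hasFDerivAt_apply i 0
  have hinv {f : (Fin 5 → ℝ) → ℝ} {f' : (Fin 5 → ℝ) →L[ℝ] ℝ} (hf : HasFDerivAt f f' 0)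
      (h0 : f 0 ≠ 0) : HasFDerivAt (fun v => (f v)⁻¹) (-(f 0 ^ 2)⁻¹ • f') 0 :=
    (hasDerivAt_inv h0).comp_hasFDerivAt 0 hf
  have hroll := ((h 0).sin.fun_mul (h 2).sin).fun_mul
    (hinv ((h 0).cos.fun_mul (h 1).cos) (by simp))
  have hpitch := ((h 1).sin.fun_mul (h 2).cos).fun_mul (hinv (h 1).cos (by simp))
  have hgain := (((h 4).const_mul (a₂ / g)).const_sub 1).fun_sub ((h 3).const_mul (a₁ / g))
  simp only [div_eq_mul_inv _ (Real.cos _), div_eq_mul_inv _ (Real.cos _ * _)]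
  refine (((hroll.fun_add hpitch).fun_mul hgain).fun_sub (h 1)).congr_fderiv ?_
  ext v
  simp
end
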